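/- Let n ≥ 3 be an integer. There exists a lattice tiling of ℤⁿ by the error ball B(n,2,1,1) if and only if there exist a finite abelian group G with identity e of order 2n² + 1 and a subset T ⊆ G such that: (1) |T| = 2n + 1, (2) e ∈ T, (3) T = T^(−1) = {t⁻¹ : t ∈ T}, and (4) T·T = 2·(Σ_{g∈G} g) + Σ_{t∈T} t² + (2n−2)·e in the integral group ring ℤ[G] (where a finite subset S of G is identified with Σ_{s∈S} s ∈ ℤ[G]). -/

import Mathlib

/-- The error ball `B(n,2,1,1)`: vectors in `ℤⁿ` with entries in `{-1,0,1}`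
and at most `2` nonzero coordinates. -/
def errBall (n : ℕ) : Set (Fin n → ℤ) :=
  {a | (∀ i, a i = -1 ∨ a i = 0 ∨ a i = 1) ∧
    (Finset.univ.filter (fun i => a i ≠ 0)).card ≤ 2}

/-- A lattice tiling of `ℤⁿ` by `V`: a subgroup `L` such that every `x ∈ ℤⁿ`
is uniquely `v + l` with `v ∈ V`, `l ∈ L`. -/
def IsLatticeTiling (n : ℕ) (V : Set (Fin n → ℤ)) (L : AddSubgroup (Fin n → ℤ)) : Prop :=
  ∀ x : Fin n → ℤ, ∃! p : (Fin n → ℤ) × (Fin n → ℤ),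
    p.1 ∈ V ∧ p.2 ∈ L ∧ x = p.1 + p.2

/-- `T` is a perfect tiling subset of `G` for parameter `n`:
`|G| = 2n²+1`, `|T| = 2n+1`, `e ∈ T`, `T = T⁽⁻¹⁾`, and
`T·T = 2·G + T⁽²⁾ + (2n-2)·e` in the integral group ring `ℤ[G]`. -/
def IsPerfectTilingSubset (n : ℕ) {G : Type} [CommGroup G] [Fintype G] [DecidableEq G]
    (T : Finset G) : Prop :=
  Fintype.card G = 2 * n ^ 2 + 1 ∧
  T.card = 2 * n + 1 ∧
  (1 : G) ∈ T ∧
  T = T.image (·⁻¹) ∧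
  (∑ t ∈ T, MonoidAlgebra.single t (1 : ℤ)) * (∑ t ∈ T, MonoidAlgebra.single t (1 : ℤ))
    = 2 * (∑ g : G, MonoidAlgebra.single g (1 : ℤ))
      + (∑ t ∈ T, MonoidAlgebra.single (t ^ 2) (1 : ℤ))
      + MonoidAlgebra.single (1 : G) (2 * (n : ℤ) - 2)

/-- sign of a boolean -/
def sgB (b : Bool) : ℤ := if b then 1 else -1

abbrev WW (n : ℕ) := Fin n × Bool
abbrev EE (n : ℕ) := Unit ⊕ WW n ⊕ {p : WW n × WW n // p.1.1 < p.2.1}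

/-- evaluation of an index with given values -/
def evE {n : ℕ} {R : Type} [MulOneClass R] (s : WW n → R) : EE n → R
  | Sum.inl _ => 1
  | Sum.inr (Sum.inl w) => s w
  | Sum.inr (Sum.inr p) => s p.1.1 * s p.1.2

def vecE {n : ℕ} : EE n → (Fin n → ℤ)
  | Sum.inl _ => fun _ => 0
  | Sum.inr (Sum.inl w) => fun k => if k = w.1 then sgB w.2 else 0
  | Sum.inr (Sum.inr p) => fun k => (if k = p.1.1.1 then sgB p.1.1.2 else 0) + 
      (if k = p.1.2.1 then sgB p.1.2.2 else 0)

lemma sgB_cases (b : Bool) : sgB b = 1 ∨ sgB b = -1 := by cases b <;> simp [sgB]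

lemma sgB_inj {b c : Bool} (h : sgB b = sgB c) : b = c := by
  cases b <;> cases c <;> simp_all [sgB]

lemma exists_sgB {x : ℤ} (h : x = -1 ∨ x = 0 ∨ x = 1) (h0 : x ≠ 0) : ∃ b, sgB b = x := by
  rcases h with h | h | h
  · exact ⟨false, by simp [sgB, h]⟩
  · exact absurd h h0
  · exact ⟨true, by simp [sgB, h]⟩

lemma vecE_inj {n : ℕ} : Function.Injective (vecE (n := n)) := by
  rintro (⟨⟩ | ⟨i, b⟩ | ⟨⟨⟨i, b⟩, ⟨j, c⟩⟩, hp⟩) (⟨⟩ | ⟨i', b'⟩ | ⟨⟨⟨i', b'⟩, ⟨j', c'⟩⟩, hp'⟩) h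
  · rfl
  · have h1 := congrFun h i'
    have := sgB_cases b'
    simp [vecE] at h1; omega
  · have h1 := congrFun h i'
    have := sgB_cases b'
    simp only at hp'
    simp [vecE, hp'.ne] at h1; omega
  · have h1 := congrFun h i
    have := sgB_cases b
    simp [vecE] at h1; omega
  · have h1 := congrFun h i
    have := sgB_cases b
    have : i = i' := by
      by_contra hne
      simp [vecE, hne] at h1; omega
    subst this
    simp [vecE] at h1
    rw [sgB_inj h1]
  · have h1 := congrFun h i'
    have h2 := congrFun h j'
    have := sgB_cases b'
    have := sgB_cases c'
    simp only at hp'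
    simp only [vecE] at h1 h2
    grind
  · have h1 := congrFun h i
    have := sgB_cases b
    simp only at hp
    simp [vecE, hp.ne] at h1; omega
  · have h1 := congrFun h i
    have h2 := congrFun h j
    have := sgB_cases b
    have := sgB_cases c
    simp only at hp
    simp only [vecE] at h1 h2
    grind
  · have h1 := congrFun h i
    have h2 := congrFun h j
    have h3 := congrFun h i'
    have h4 := congrFun h j'
    have := sgB_cases b
    have := sgB_cases c
    have := sgB_cases b'
    have := sgB_cases c'
    simp only at hp hp'
    simp only [vecE] at h1 h2 h3 h4
    have e1 : i = i' := by grind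
    have e2 : j = j' := by grind
    subst e1 e2
    have e3 : b = b' := sgB_inj (by grind)
    have e4 : c = c' := sgB_inj (by grind)
    subst e3 e4
    rfl

lemma vecE_mem {n : ℕ} (e : EE n) : vecE e ∈ errBall n := by
  rcases e with (⟨⟩ | ⟨i, b⟩ | ⟨⟨⟨i, b⟩, ⟨j, c⟩⟩, hp⟩)
  · simp [errBall, vecE]
  · refine ⟨fun k => ?_, ?_⟩
    · have := sgB_cases b
      simp only [vecE]
      grind
    · refine (Finset.card_le_card (t := {i}) ?_).trans (by simp)
      intro k
      simp only [vecE]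
      grind
  · simp only at hp
    refine ⟨fun k => ?_, ?_⟩
    · have := sgB_cases b
      have := sgB_cases c
      simp only [vecE]
      grind
    · refine (Finset.card_le_card (t := {i, j}) ?_).trans Finset.card_le_two
      intro k
      simp only [vecE]
      grind

lemma vecE_surj {n : ℕ} (a : Fin n → ℤ) (ha : a ∈ errBall n) : ∃ e, vecE e = a := by
  obtain ⟨h1, h2⟩ := ha
  have hmem : ∀ k, k ∈ (Finset.univ.filter (fun i => a i ≠ 0)) ↔ a k ≠ 0 := by simp
  generalize Finset.univ.filter (fun i => a i ≠ 0) = S at h2 hmem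
  interval_cases hS : S.card
  · rw [Finset.card_eq_zero] at hS
    subst hS
    refine ⟨Sum.inl (), ?_⟩
    funext k
    have := hmem k
    simp only [vecE]
    grind
  · rw [Finset.card_eq_one] at hS
    obtain ⟨i, rfl⟩ := hS
    obtain ⟨b, hb⟩ := exists_sgB (h1 i) (by rw [← hmem]; simp)
    refine ⟨Sum.inr (Sum.inl (i, b)), ?_⟩
    funext k
    have := hmem k
    simp only [vecE]
    grind
  · rw [Finset.card_eq_two] at hS
    obtain ⟨i, j, hij, rfl⟩ := hS
    obtain ⟨b, hb⟩ := exists_sgB (h1 i) (by rw [← hmem]; simp)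
    obtain ⟨c, hc⟩ := exists_sgB (h1 j) (by rw [← hmem]; simp)
    rcases lt_or_gt_of_ne hij with h | h
    · refine ⟨Sum.inr (Sum.inr ⟨((i, b), (j, c)), h⟩), ?_⟩
      funext k
      have := hmem k
      simp only [vecE]
      grind
    · refine ⟨Sum.inr (Sum.inr ⟨((j, c), (i, b)), h⟩), ?_⟩
      funext k
      have := hmem k
      simp only [vecE]
      grind

lemma sum_EE {n : ℕ} {R : Type} [CommRing R] (σ : WW n → R)
    (hσ : ∀ i, σ (i, true) * σ (i, false) = 1) :
    (1 + ∑ w, σ w) * (1 + ∑ w, σ w) =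
      2 * (∑ e : EE n, evE σ e) + (1 + ∑ w, σ w ^ 2) + ((2 * n - 2 : ℤ) : R) := by
  have hE : ∑ e : EE n, evE σ e = 1 + ∑ w, σ w +
      ∑ p : WW n × WW n, if p.1.1 < p.2.1 then σ p.1 * σ p.2 else 0 := by
    rw [Fintype.sum_sum_type, Fintype.sum_sum_type, ← Finset.sum_filter]
    rw [Finset.sum_subtype (p := fun p : WW n × WW n => p.1.1 < p.2.1)
      (F := inferInstance) _ (by simp)]
    simp [evE, add_assoc]
  have hsw : (∑ p : WW n × WW n, if p.1.1 < p.2.1 then σ p.1 * σ p.2 else 0) =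
      ∑ p : WW n × WW n, if p.2.1 < p.1.1 then σ p.1 * σ p.2 else 0 := by
    rw [← (Equiv.prodComm (WW n) (WW n)).sum_comp]
    simp [mul_comm]
  have hd : (∑ p : WW n × WW n, if p.1.1 = p.2.1 then σ p.1 * σ p.2 else 0) =
      ∑ w, σ w ^ 2 + 2 * n := by
    simp only [Fintype.sum_prod_type, Fintype.sum_bool]
    simp only [Finset.sum_add_distrib, Finset.sum_ite_eq, Finset.mem_univ, if_true]
    have : ∀ i, σ (i, false) * σ (i, true) = 1 := fun i => by rw [mul_comm, hσ]
    simp [hσ, this, ← pow_two]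
    ring
  have hall : (∑ w, σ w) * (∑ w, σ w) = ∑ p : WW n × WW n, σ p.1 * σ p.2 := by
    rw [Fintype.sum_mul_sum, ← Fintype.sum_prod_type']
  have hsplit : (∑ p : WW n × WW n, σ p.1 * σ p.2) =
     (∑ p : WW n × WW n, if p.1.1 < p.2.1 then σ p.1 * σ p.2 else 0) +
     (∑ p : WW n × WW n, if p.1.1 = p.2.1 then σ p.1 * σ p.2 else 0) +
     (∑ p : WW n × WW n, if p.2.1 < p.1.1 then σ p.1 * σ p.2 else 0) := by
    rw [← Finset.sum_add_distrib, ← Finset.sum_add_distrib]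
    refine Finset.sum_congr rfl fun p _ => ?_
    rcases lt_trichotomy p.1.1 p.2.1 with h | h | h
    · simp [h, h.ne, h.not_gt]
    · simp [h]
    · simp [h, h.ne', h.not_gt]
  rw [hE]
  rw [← hsw, hd] at hsplit
  push_cast
  linear_combination hall + hsplit

lemma card_EE (n : ℕ) : Fintype.card (EE n) = 2 * n ^ 2 + 1 := by
  have h := sum_EE (n := n) (R := ℤ) (fun _ => 1) (by simp)
  have h1 : ∀ e : EE n, evE (fun _ => (1 : ℤ)) e = 1 := by
    rintro (_ | _ | _) <;> simp [evE]
  simp only [h1] at h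
  simp only [Finset.sum_const, Finset.card_univ, Fintype.card_prod, Fintype.card_fin,
    Fintype.card_bool, nsmul_eq_mul] at h
  zify
  push_cast at h
  linarith

/-- signed generators -/
def sG {n : ℕ} {G : Type} [CommGroup G] (g : Fin n → G) (w : WW n) : G := g w.1 ^ (sgB w.2)

lemma sG_inv {n : ℕ} {G : Type} [CommGroup G] (g : Fin n → G) (i : Fin n) (b : Bool) :
    (sG g (i, b))⁻¹ = sG g (i, !b) := by
  cases b <;> simp [sG, sgB]

lemma sum_sG {n : ℕ} {G : Type} [CommGroup G] (g : Fin n → G) :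
    (1 + ∑ w, MonoidAlgebra.single (sG g w) (1 : ℤ)) *
      (1 + ∑ w, MonoidAlgebra.single (sG g w) (1 : ℤ)) =
      2 * (∑ e : EE n, MonoidAlgebra.single (evE (sG g) e) (1 : ℤ)) +
       (1 + ∑ w, MonoidAlgebra.single (sG g w ^ 2) (1 : ℤ)) +
       MonoidAlgebra.single (1 : G) (2 * (n : ℤ) - 2) := by
  rw [sum_EE]
  · congr 2
    · congr 2
      funext e
      rcases e with (_ | _ | _) <;> simp [evE, MonoidAlgebra.one_def, MonoidAlgebra.single_mul_single]
    · simp [MonoidAlgebra.single_pow]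
  · intro i
    simp [sG, sgB, MonoidAlgebra.single_mul_single, MonoidAlgebra.one_def]

/-- the hom -/
lemma hom_vecE {n : ℕ} {G : Type} [CommGroup G] (g : Fin n → G) (e : EE n) :
    ∏ i, g i ^ (vecE e i) = evE (sG g) e := by
  rcases e with (_ | w | p)
  · simp [vecE, evE]
  · simp only [vecE, evE, sG]
    rw [Finset.prod_eq_single w.1] <;> simp +contextual
  · simp only [vecE, evE, sG, zpow_add, Finset.prod_mul_distrib]
    congr 1
    · rw [Finset.prod_eq_single p.1.1.1] <;> simp +contextual
    · rw [Finset.prod_eq_single p.1.2.1] <;> simp +contextual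

lemma fwd (n : ℕ) (L : AddSubgroup (Fin n → ℤ)) (hL : IsLatticeTiling n (errBall n) L) :
    ∃ (G : Type) (_ : CommGroup G) (_ : Fintype G) (_ : DecidableEq G) (T : Finset G),
        IsPerfectTilingSubset n T := by
  classical
  let G := Multiplicative ((Fin n → ℤ) ⧸ L)
  let π : (Fin n → ℤ) → G := fun x => Multiplicative.ofAdd (QuotientAddGroup.mk x)
  let g : Fin n → G := fun i => π (Pi.single i 1)
  have hπ : ∀ x, π x = ∏ i, g i ^ (x i) := by
    intro x
    have hx : x = ∑ i, x i • (Pi.single i 1 : Fin n → ℤ) := by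
      funext k
      simp [Finset.sum_apply, Pi.single_apply]
    let Φ : (Fin n → ℤ) →+ ((Fin n → ℤ) ⧸ L) := QuotientAddGroup.mk' L
    have : Φ x = ∑ i, x i • Φ (Pi.single i 1) := by
      conv_lhs => rw [hx]
      simp only [map_sum, map_zsmul]
    exact congrArg Multiplicative.ofAdd this
  have hπe : ∀ e, π (vecE e) = evE (sG g) e := fun e => by rw [hπ, hom_vecE]
  have heq : ∀ x y, π x = π y ↔ -x + y ∈ L := fun x y => by
    simp only [π, EmbeddingLike.apply_eq_iff_eq]
    exact QuotientAddGroup.eq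
  have hbij : Function.Bijective (evE (sG g)) := by
    constructor
    · intro e e' h
      rw [← hπe, ← hπe, heq] at h
      have := (hL (vecE e')).unique (y₁ := (vecE e', 0)) (y₂ := (vecE e, -vecE e + vecE e'))
        ⟨vecE_mem _, L.zero_mem, by simp⟩ ⟨vecE_mem _, h, by simp⟩
      exact vecE_inj (congrArg Prod.fst this).symm
    · intro y
      obtain ⟨x, rfl⟩ : ∃ x, π x = y := by
        obtain ⟨x, hx⟩ := QuotientAddGroup.mk_surjective (Multiplicative.toAdd y)
        exact ⟨x, by simp only [π]; rw [hx]; rfl⟩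
      obtain ⟨⟨v, l⟩, ⟨hv, hl, hx⟩, -⟩ := hL x
      obtain ⟨e, rfl⟩ := vecE_surj v hv
      refine ⟨e, ?_⟩
      rw [← hπe, heq, hx]
      simpa using hl
  let eq := Equiv.ofBijective _ hbij
  let _ : Fintype G := Fintype.ofEquiv _ eq
  have hinj : Function.Injective (sG g) := fun w w' h => by
    have := @hbij.1 (Sum.inr (Sum.inl w)) (Sum.inr (Sum.inl w')) h
    simpa using this
  have h1 : (1 : G) ∉ Finset.univ.image (sG g) := by
    intro h
    simp only [Finset.mem_image, Finset.mem_univ, true_and] at h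
    obtain ⟨w, hw⟩ := h
    have := @hbij.1 (Sum.inr (Sum.inl w)) (Sum.inl ()) hw
    simp at this
  refine ⟨G, inferInstance, inferInstance, inferInstance, insert 1 (Finset.univ.image (sG g)), ?_, ?_, ?_, ?_, ?_⟩
  · rw [← card_EE n]
    exact (Fintype.card_congr eq).symm
  · rw [Finset.card_insert_of_notMem h1, Finset.card_image_of_injective _ hinj]
    simp [mul_comm]
  · simp
  · have hinv : ∀ i b, (sG g (i, b))⁻¹ = sG g (i, !b) := by
      intro i b
      exact sG_inv g i b
    ext x
    simp only [Finset.mem_insert, Finset.mem_image, Finset.mem_univ, true_and]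
    constructor
    · rintro (rfl | ⟨⟨i, b⟩, rfl⟩)
      · exact ⟨1, by simp⟩
      · exact ⟨sG g (i, !b), Or.inr ⟨_, rfl⟩, by rw [hinv]; simp⟩
    · rintro ⟨y, (rfl | ⟨⟨i, b⟩, rfl⟩), rfl⟩
      · simp
      · exact Or.inr ⟨_, (hinv i b).symm⟩
  · simp only [Finset.sum_insert h1, Finset.sum_image (fun _ _ _ _ h => hinj h), one_pow,
      ← MonoidAlgebra.one_def]
    rw [sum_sG, ← eq.sum_comp]
    rfl

lemma bwd_aux (n : ℕ) (G : Type) [CommGroup G] [Fintype G] [DecidableEq G] (T : Finset G)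
    (hT : IsPerfectTilingSubset n T) :
    ∃ g : Fin n → G, Function.Injective (sG g) ∧ (1 : G) ∉ Finset.univ.image (sG g) ∧
      T = insert 1 (Finset.univ.image (sG g)) := by
  obtain ⟨hG, hc, h1, hinv, -⟩ := hT
  have hinv' : ∀ t ∈ T, t⁻¹ ∈ T := fun t ht => by
    rw [hinv]; exact Finset.mem_image_of_mem _ ht
  have hodd : ∀ t : G, t = t⁻¹ → t = 1 := by
    intro t ht
    have h2 : t ^ 2 = 1 := by
      rw [pow_two]; nth_rewrite 2 [ht]; simp
    have h3 := orderOf_dvd_of_pow_eq_one h2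
    have h4 := orderOf_dvd_card (x := t)
    rw [hG] at h4
    have h5 : orderOf t ∣ 1 := by
      rw [← Nat.dvd_add_right (dvd_mul_of_dvd_left h3 (n ^ 2))]
      exact h4
    exact orderOf_eq_one_iff.1 (Nat.dvd_one.1 h5)
  let e := Fintype.equivFin G
  let A := T.filter (fun t => e t < e t⁻¹)
  have hA : ∀ t, t ∈ A ↔ t ∈ T ∧ e t < e t⁻¹ := by simp [A]
  have hTA : T = insert 1 (A ∪ A.image (·⁻¹)) := by
    ext t
    simp only [Finset.mem_insert, Finset.mem_union, Finset.mem_image, hA]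
    constructor
    · intro ht
      rcases lt_trichotomy (e t) (e t⁻¹) with h | h | h
      · exact Or.inr (Or.inl ⟨ht, h⟩)
      · exact Or.inl (hodd t (e.injective h))
      · exact Or.inr (Or.inr ⟨t⁻¹, ⟨hinv' t ht, by simpa using h⟩, by simp⟩)
    · rintro (rfl | h | ⟨s, hs, rfl⟩)
      · exact h1
      · exact h.1
      · exact hinv' _ hs.1
  have hdis : ∀ a ∈ A, ∀ b ∈ A, a ≠ b⁻¹ := by
    rintro a ha b hb rfl
    rw [hA] at ha hb
    have := ha.2
    rw [inv_inv] at this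
    exact lt_asymm this hb.2
  have hA1 : (1 : G) ∉ A := fun h => hdis 1 h 1 h (by simp)
  have h1' : (1 : G) ∉ A ∪ A.image (·⁻¹) := by simp [hA1]
  have hcard : A.card = n := by
    have := hc
    rw [hTA, Finset.card_insert_of_notMem h1', Finset.card_union_of_disjoint,
      Finset.card_image_of_injective _ inv_injective] at this
    · omega
    · rw [Finset.disjoint_left]
      intro a ha ha'
      obtain ⟨b, hb, hab⟩ := Finset.mem_image.1 ha'
      exact hdis a ha b hb hab.symm
  let ψ := (A.equivFinOfCardEq hcard).symm
  let g : Fin n → G := fun i => (ψ i : G)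
  have hgA : ∀ i, g i ∈ A := fun i => (ψ i).2
  have hginj : Function.Injective g := fun i j h => ψ.injective (Subtype.ext h)
  have himg : Finset.univ.image (sG g) = A ∪ A.image (·⁻¹) := by
    ext t
    simp only [Finset.mem_union, Finset.mem_image, Finset.mem_univ, true_and]
    constructor
    · rintro ⟨⟨i, b⟩, rfl⟩
      cases b
      · exact Or.inr ⟨g i, hgA i, by simp [sG, sgB]⟩
      · exact Or.inl (by simpa [sG, sgB] using hgA i)
    · rintro (h | ⟨s, h, rfl⟩)
      · obtain ⟨i, hi⟩ := ψ.surjective ⟨t, h⟩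
        exact ⟨(i, true), by simp [sG, sgB, g, hi]⟩
      · obtain ⟨i, hi⟩ := ψ.surjective ⟨s, h⟩
        exact ⟨(i, false), by simp [sG, sgB, g, hi]⟩
  refine ⟨g, ?_, by rw [himg]; exact h1', by rw [himg]; exact hTA⟩
  rintro ⟨i, b⟩ ⟨j, c⟩ h
  have h5 := hdis _ (hgA i) _ (hgA j)
  have h6 := hdis _ (hgA j) _ (hgA i)
  cases b <;> cases c <;> simp [sG, sgB] at h ⊢
  · exact hginj h
  · exact h6 h.symm
  · exact h5 h
  · exact hginj h

lemma bwd (n : ℕ) (G : Type) [CommGroup G] [Fintype G] [DecidableEq G] (T : Finset G)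
    (hT : IsPerfectTilingSubset n T) :
    ∃ L : AddSubgroup (Fin n → ℤ), IsLatticeTiling n (errBall n) L := by
  obtain ⟨g, hinj, h1, rfl⟩ := bwd_aux n G T hT
  obtain ⟨hG, hc, -, -, hsum⟩ := hT
  simp only [Finset.sum_insert h1, Finset.sum_image (fun _ _ _ _ h => hinj h), one_pow,
      ← MonoidAlgebra.one_def] at hsum
  rw [sum_sG] at hsum
  have hsum2 : 2 * (∑ e : EE n, MonoidAlgebra.single (evE (sG g) e) (1 : ℤ)) =
      2 * (∑ g : G, MonoidAlgebra.single g (1 : ℤ)) := 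
    add_right_cancel (add_right_cancel hsum)
  have hsurj : Function.Surjective (evE (sG g)) := by
    intro y
    by_contra hne
    push Not at hne
    have := congrArg (fun f : MonoidAlgebra ℤ G => f.coeff y) hsum2
    simp [two_mul, Finsupp.single_apply, hne] at this
  have hbij : Function.Bijective (evE (sG g)) := by
    rw [Fintype.bijective_iff_surjective_and_card]
    exact ⟨hsurj, by rw [card_EE, hG]⟩
  let Φ : (Fin n → ℤ) →+ Additive G :=
    { toFun := fun x => Additive.ofMul (∏ i, g i ^ (x i))
      map_zero' := by simp
      map_add' := fun x y => by
        simp only [Pi.add_apply, zpow_add, Finset.prod_mul_distrib, ofMul_mul] }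
  have hΦ : ∀ e, Φ (vecE e) = Additive.ofMul (evE (sG g) e) := fun e => 
    congrArg Additive.ofMul (hom_vecE g e)
  refine ⟨Φ.ker, fun x => ?_⟩
  obtain ⟨e, he⟩ := hbij.2 (Additive.toMul (Φ x))
  have he' : Φ (vecE e) = Φ x := by rw [hΦ, he]; rfl
  refine ⟨(vecE e, x - vecE e), ⟨vecE_mem e, ?_, by simp⟩, ?_⟩
  · simp [AddMonoidHom.mem_ker, he']
  · rintro ⟨v, l⟩ ⟨hv, hl, hx⟩
    simp only at hv hl hx
    obtain ⟨e', rfl⟩ := vecE_surj v hv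
    have h2 : Φ (vecE e') = Φ x := by
      rw [hx, map_add, AddMonoidHom.mem_ker.1 hl, add_zero]
    rw [← he', hΦ, hΦ] at h2
    have h3 : e' = e := hbij.1 (Additive.ofMul.injective h2)
    subst h3
    rw [hx]; simp

theorem stmt2 (n : ℕ) (hn : 3 ≤ n) :
    (∃ L : AddSubgroup (Fin n → ℤ), IsLatticeTiling n (errBall n) L) ↔
      ∃ (G : Type) (_ : CommGroup G) (_ : Fintype G) (_ : DecidableEq G) (T : Finset G),
        IsPerfectTilingSubset n T := by
  constructor
  · rintro ⟨L, hL⟩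
    exact fwd n L hL
  · rintro ⟨G, _, _, _, T, hT⟩
    exact bwd n G T hT
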